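/- arXiv:1908.06313 — 3 statements merged into one kernel-verified Lean document; each statement's English description precedes it below -/
import Mathlib

section
/- Let I : (0,∞) → (0,∞) be non-decreasing and m ∈ ℕ. Then for every non-negative measurable f on (0,∞) and every t ∈ (0,∞), H_I^m f(t) = (1/(m−1)!) · ∫_t^∞ (f(s)/I(s)) (∫_t^s 1/I(r) dr)^{m−1} ds. -/
open MeasureTheory Set Filter
open scoped ENNReal NNReal Topology

noncomputable section

/-- The distribution function of `f`, viewed as a function on `(0,∞)` with Lebesgue measure:
`μ_f(s) = λ({t ∈ (0,∞) : f(t) > s})`. -/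
def distrib (f : ℝ → ℝ≥0∞) (s : ℝ≥0∞) : ℝ≥0∞ :=
  volume {t : ℝ | t ∈ Set.Ioi (0 : ℝ) ∧ s < f t}

/-- The non-increasing rearrangement `f*(t) = inf { s ≥ 0 : μ_f(s) ≤ t }`. -/
def rearr (f : ℝ → ℝ≥0∞) (t : ℝ) : ℝ≥0∞ :=
  sInf {s : ℝ≥0∞ | distrib f s ≤ ENNReal.ofReal t}

/-- The operator `R_I f(t) = (1/I(t)) ∫_0^t f(s) ds`. -/
def RI (I : ℝ → ℝ) (f : ℝ → ℝ≥0∞) : ℝ → ℝ≥0∞ :=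
  fun t => (∫⁻ s in Set.Ioc (0 : ℝ) t, f s) / ENNReal.ofReal (I t)

/-- The operator `H_I f(t) = ∫_t^∞ f(s)/I(s) ds`. -/
def HI (I : ℝ → ℝ) (f : ℝ → ℝ≥0∞) : ℝ → ℝ≥0∞ :=
  fun t => ∫⁻ s in Set.Ioi t, f s / ENNReal.ofReal (I s)

/-- `G_I^m f(t) = sup_{s ≥ t} R_I^m f*(s)`. -/
def GI (I : ℝ → ℝ) (m : ℕ) (f : ℝ → ℝ≥0∞) : ℝ → ℝ≥0∞ :=
  fun t => ⨆ s ∈ Set.Ici t, (RI I)^[m] (rearr f) s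

/-- `Φ_I^m(t,s) = (∫_s^t 1/I(τ) dτ)^(m-1) / I(t)`. -/
def Phi (I : ℝ → ℝ) (m : ℕ) (t s : ℝ) : ℝ :=
  (∫ τ in s..t, 1 / I τ) ^ (m - 1) / I t

/-- `Φ_I^m(t,s)` is essentially decreasing in `t`. -/
def EssentiallyDecreasingIn (I : ℝ → ℝ) (m : ℕ) : Prop :=
  ∀ s₀ ∈ Set.Ioi (0 : ℝ), ∃ t₀ ∈ Set.Ioi (0 : ℝ), ∀ t ∈ Set.Ioi t₀,
    ∃ rt ∈ Set.Ioi (0 : ℝ), ∀ r ∈ Set.Ioi rt, ∀ s ∈ Set.Ioo (0 : ℝ) s₀,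
      Phi I m r s ≤ Phi I m t s

/-- The kernel operator `f ↦ (t ↦ ∫_t^∞ (f(s)/I(s)) (∫_t^s 1/I(r) dr)^(m-1) ds)`. -/
def kernelOp (I : ℝ → ℝ) (m : ℕ) (f : ℝ → ℝ≥0∞) : ℝ → ℝ≥0∞ :=
  fun t => ∫⁻ s in Set.Ioi t,
    (f s / ENNReal.ofReal (I s)) * (ENNReal.ofReal (∫ r in t..s, 1 / I r)) ^ (m - 1)

/-- A Banach function norm on (non-negative) measurable functions on `(0,∞)`
(with Lebesgue measure). -/
structure BanachFunctionNorm where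
  /-- The norm functional. -/
  N : (ℝ → ℝ≥0∞) → ℝ≥0∞
  /-- Positive homogeneity. -/
  smul : ∀ (c : ℝ≥0) (f : ℝ → ℝ≥0∞), Measurable f →
    N (fun t => (c : ℝ≥0∞) * f t) = (c : ℝ≥0∞) * N f
  /-- The norm vanishes exactly on a.e.-zero functions. -/
  eq_zero_iff : ∀ f : ℝ → ℝ≥0∞, Measurable f →
    (N f = 0 ↔ ∀ᵐ t ∂(volume.restrict (Set.Ioi (0 : ℝ))), f t = 0)
  /-- Subadditivity. -/
  add_le : ∀ f g : ℝ → ℝ≥0∞, Measurable f → Measurable g →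
    N (fun t => f t + g t) ≤ N f + N g
  /-- The lattice property. -/
  mono : ∀ f g : ℝ → ℝ≥0∞, Measurable f → Measurable g →
    (∀ᵐ t ∂(volume.restrict (Set.Ioi (0 : ℝ))), f t ≤ g t) → N f ≤ N g
  /-- The Fatou property: `f_n ↑ f` a.e. implies `‖f_n‖ ↑ ‖f‖`. -/
  fatou : ∀ (f : ℕ → ℝ → ℝ≥0∞) (g : ℝ → ℝ≥0∞), (∀ n, Measurable (f n)) →
    Measurable g →
    (∀ᵐ t ∂(volume.restrict (Set.Ioi (0 : ℝ))), Monotone fun n => f n t) →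
    (∀ᵐ t ∂(volume.restrict (Set.Ioi (0 : ℝ))), g t = ⨆ n, f n t) →
    N g = ⨆ n, N (f n)
  /-- Characteristic functions of sets of finite measure have finite norm. -/
  indicator_lt_top : ∀ E : Set ℝ, MeasurableSet E → E ⊆ Set.Ioi (0 : ℝ) →
    volume E < ∞ → N (E.indicator 1) < ∞
  /-- Local embedding into `L¹`. -/
  exists_integral_le : ∀ E : Set ℝ, MeasurableSet E → E ⊆ Set.Ioi (0 : ℝ) →
    volume E < ∞ → ∃ C : ℝ≥0∞, C ≠ ∞ ∧
      ∀ f : ℝ → ℝ≥0∞, Measurable f → ∫⁻ t in E, f t ≤ C * N f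

/-- A rearrangement-invariant Banach function norm: equimeasurable functions have
equal norms. -/
structure RIBanachFunctionNorm extends BanachFunctionNorm where
  /-- Rearrangement invariance. -/
  ri : ∀ f g : ℝ → ℝ≥0∞, Measurable f → Measurable g →
    (∀ s, distrib f s = distrib g s) → N f = N g

/-- The associate norm `‖f‖_{X'} = sup { ∫_0^∞ |f g| : ‖g‖_X ≤ 1 }`. -/
def assocNorm (X : RIBanachFunctionNorm) (f : ℝ → ℝ≥0∞) : ℝ≥0∞ :=
  ⨆ (g : ℝ → ℝ≥0∞) (_ : Measurable g) (_ : X.N g ≤ 1),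
    ∫⁻ t in Set.Ioi (0 : ℝ), f t * g t

/-- The down-associate norm `‖f‖_{X'_d} = sup { ∫_0^∞ |f| g* : ‖g‖_X ≤ 1 }`. -/
def downAssocNorm (X : RIBanachFunctionNorm) (f : ℝ → ℝ≥0∞) : ℝ≥0∞ :=
  ⨆ (g : ℝ → ℝ≥0∞) (_ : Measurable g) (_ : X.N g ≤ 1),
    ∫⁻ t in Set.Ioi (0 : ℝ), f t * rearr g t

section ClosedFormula

variable {J : ℝ → ℝ}

lemma intervalIntegrable_one_div (hJ : Monotone J) (hpos : ∀ x, 0 < J x) (a b : ℝ) :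
    IntervalIntegrable (fun r => 1 / J r) volume a b := by
  have hanti : Antitone fun r => 1 / J r := fun x y hxy =>
    one_div_le_one_div_of_le (hpos x) (hJ hxy)
  exact hanti.intervalIntegrable

lemma div_ofReal_eq_mul (hpos : ∀ x, 0 < J x) (a : ℝ≥0∞) (s : ℝ) :
    a / ENNReal.ofReal (J s) = a * ENNReal.ofReal (1 / J s) := by
  rw [one_div, ENNReal.ofReal_inv_of_pos (hpos s), div_eq_mul_inv]

/-- Integrating a power of the tail integral of `1 / J` against `1 / J`. -/
lemma lintegral_one_div_mul_pow (hJ : Monotone J) (hpos : ∀ x, 0 < J x) (n : ℕ)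
    {t u : ℝ} (htu : t ≤ u) :
    ∫⁻ s in Ioc t u, ENNReal.ofReal (1 / J s) * ENNReal.ofReal (∫ r in s..u, 1 / J r) ^ n =
      ((n + 1 : ℕ) : ℝ≥0∞)⁻¹ * ENNReal.ofReal (∫ r in t..u, 1 / J r) ^ (n + 1) := by
  have hint := intervalIntegrable_one_div hJ hpos
  have hk : ∀ r, 0 ≤ 1 / J r := fun r => (one_div_pos.2 (hpos r)).le
  have hP : ∀ s ≤ u, 0 ≤ ∫ r in s..u, 1 / J r := fun s hs =>
    intervalIntegral.integral_nonneg hs fun r _ => hk r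
  have hcont : Continuous fun s => ∫ r in s..u, 1 / J r := by
    simp_rw [intervalIntegral.integral_symm u]
    exact (intervalIntegral.continuous_primitive hint u).neg
  have hprod : IntervalIntegrable (fun s => 1 / J s * (∫ r in s..u, 1 / J r) ^ n) volume t u :=
    (hint t u).mul_continuousOn (hcont.pow n).continuousOn
  have hderiv : ∀ s, ContinuousAt J s → HasDerivAt
      (fun s => -((n + 1 : ℝ)⁻¹ * (∫ r in s..u, 1 / J r) ^ (n + 1)))
      (1 / J s * (∫ r in s..u, 1 / J r) ^ n) s := by
    intro s hs
    have hc : ContinuousAt (fun r => 1 / J r) s := continuousAt_const.div hs (hpos s).ne'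
    have hm : StronglyMeasurable fun r => 1 / J r :=
      (hJ.measurable.const_div 1).stronglyMeasurable
    have hd := intervalIntegral.integral_hasDerivAt_left (hint s u)
      hm.stronglyMeasurableAtFilter hc
    refine ((hd.pow (n + 1)).const_mul (n + 1 : ℝ)⁻¹).neg.congr_deriv ?_
    have : (n + 1 : ℝ) ≠ 0 := by positivity
    push_cast
    field_simp
  have hftc := integral_eq_of_hasDerivAt_off_countable_of_le
    (fun s => -((n + 1 : ℝ)⁻¹ * (∫ r in s..u, 1 / J r) ^ (n + 1)))
    (fun s => 1 / J s * (∫ r in s..u, 1 / J r) ^ n) htu hJ.countable_not_continuousAt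
    (by fun_prop) (fun s hs => hderiv s (by simpa using hs.2)) hprod
  calc
    _ = ∫⁻ s in Ioc t u, ENNReal.ofReal (1 / J s * (∫ r in s..u, 1 / J r) ^ n) := by
      refine setLIntegral_congr_fun measurableSet_Ioc fun s hs => ?_
      rw [ENNReal.ofReal_mul (hk s), ENNReal.ofReal_pow (hP s hs.2)]
    _ = ENNReal.ofReal (∫ s in t..u, 1 / J s * (∫ r in s..u, 1 / J r) ^ n) := by
      rw [intervalIntegral.integral_of_le htu, ofReal_integral_eq_lintegral_ofReal]
      · exact (intervalIntegrable_iff_integrableOn_Ioc_of_le htu).1 hprod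
      · exact (ae_restrict_iff' measurableSet_Ioc).2 <| .of_forall fun s hs =>
          mul_nonneg (hk s) (pow_nonneg (hP s hs.2) n)
    _ = _ := by
      rw [hftc, intervalIntegral.integral_same, zero_pow n.succ_ne_zero, mul_zero, neg_zero,
        zero_sub, neg_neg, ENNReal.ofReal_mul (by positivity), ENNReal.ofReal_pow (hP t htu),
        ENNReal.ofReal_inv_of_pos (by positivity), ← Nat.cast_succ, ENNReal.ofReal_natCast]

lemma HI_kernelOp (hJ : Monotone J) (hpos : ∀ x, 0 < J x) (n : ℕ) {f : ℝ → ℝ≥0∞}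
    (hf : Measurable f) (t : ℝ) :
    HI J (kernelOp J (n + 1) f) t = ((n + 1 : ℕ) : ℝ≥0∞)⁻¹ * kernelOp J (n + 2) f t := by
  have hint := intervalIntegrable_one_div hJ hpos
  have hk : Measurable fun s => ENNReal.ofReal (1 / J s) :=
    (hJ.measurable.const_div 1).ennreal_ofReal
  have hP : Measurable fun p : ℝ × ℝ => ENNReal.ofReal (∫ r in p.1..p.2, 1 / J r) := by
    have hprim := intervalIntegral.continuous_primitive hint 0
    have hsub : ∀ p : ℝ × ℝ, ∫ r in p.1..p.2, 1 / J r =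
        (∫ r in 0..p.2, 1 / J r) - ∫ r in 0..p.1, 1 / J r := fun p =>
      (intervalIntegral.integral_interval_sub_left (hint 0 _) (hint 0 _)).symm
    simp only [hsub]
    exact ((hprim.comp continuous_snd).sub (hprim.comp continuous_fst)).measurable.ennreal_ofReal
  simp only [HI, kernelOp, div_ofReal_eq_mul hpos, Nat.add_sub_cancel,
    show n + 2 - 1 = n + 1 from rfl]
  let F : ℝ → ℝ → ℝ≥0∞ := fun s u =>
    f u * ENNReal.ofReal (1 / J u) *
      (ENNReal.ofReal (1 / J s) * ENNReal.ofReal (∫ r in s..u, 1 / J r) ^ n)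
  have hF : Measurable (Function.uncurry F) :=
    ((hf.comp measurable_snd).mul (hk.comp measurable_snd)).mul
      ((hk.comp measurable_fst).mul (hP.pow_const n))
  let T : Set (ℝ × ℝ) := {p | p.1 ≤ p.2}
  have hT : MeasurableSet T := measurableSet_le measurable_fst measurable_snd
  calc
    _ = ∫⁻ s in Ioi t, ∫⁻ u in Ioi t, T.indicator (Function.uncurry F) (s, u) := by
      refine setLIntegral_congr_fun measurableSet_Ioi fun s hs => ?_
      have h1 : (fun u => T.indicator (Function.uncurry F) (s, u)) =
          (Ici s).indicator (F s) := by
        ext u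
        simp [T, indicator, Function.uncurry]
      rw [h1, setLIntegral_indicator measurableSet_Ici,
        inter_eq_left.2 (Ici_subset_Ioi.2 hs), ← restrict_Ioi_eq_restrict_Ici,
        mul_comm, ← lintegral_const_mul']
      · refine lintegral_congr fun u => ?_
        simp only [F]
        ring
      · exact ENNReal.ofReal_ne_top
    _ = ∫⁻ u in Ioi t, ∫⁻ s in Ioi t, T.indicator (Function.uncurry F) (s, u) :=
      lintegral_lintegral_swap (f := fun s u => T.indicator (Function.uncurry F) (s, u))
        (hF.indicator hT).aemeasurable
    _ = ∫⁻ u in Ioi t, ((n + 1 : ℕ) : ℝ≥0∞)⁻¹ * (f u * ENNReal.ofReal (1 / J u) *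
          ENNReal.ofReal (∫ r in t..u, 1 / J r) ^ (n + 1)) := by
      refine setLIntegral_congr_fun measurableSet_Ioi fun u hu => ?_
      have h1 : (fun s => T.indicator (Function.uncurry F) (s, u)) =
          (Iic u).indicator (fun s => F s u) := by
        ext s
        simp [T, indicator, Function.uncurry]
      rw [h1, setLIntegral_indicator measurableSet_Iic, Iic_inter_Ioi, lintegral_const_mul,
        lintegral_one_div_mul_pow hJ hpos n (le_of_lt hu)]
      · ring
      · exact hk.mul ((hP.comp (measurable_id.prodMk measurable_const)).pow_const n)
    _ = _ := lintegral_const_mul' _ _ (ENNReal.inv_ne_top.2 (by simp))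

/-- The closed formula for a weight that is monotone and positive on the whole line. -/
lemma iterate_HI_eq_kernelOp (hJ : Monotone J) (hpos : ∀ x, 0 < J x) (n : ℕ)
    {f : ℝ → ℝ≥0∞} (hf : Measurable f) :
    (HI J)^[n + 1] f = fun t => (Nat.factorial n : ℝ≥0∞)⁻¹ * kernelOp J (n + 1) f t := by
  induction n with
  | zero =>
    ext t
    simp [HI, kernelOp]
  | succ n ih =>
    ext t
    have hne : (Nat.factorial n : ℝ≥0∞)⁻¹ ≠ ∞ :=
      ENNReal.inv_ne_top.2 (by exact_mod_cast n.factorial_ne_zero)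
    rw [Function.iterate_succ_apply', ih]
    have hsmul : HI J (fun t => (Nat.factorial n : ℝ≥0∞)⁻¹ * kernelOp J (n + 1) f t) t =
        (Nat.factorial n : ℝ≥0∞)⁻¹ * HI J (kernelOp J (n + 1) f) t := by
      simp only [HI, mul_div_assoc]
      exact lintegral_const_mul' _ _ hne
    rw [hsmul, HI_kernelOp hJ hpos n hf, ← mul_assoc, Nat.factorial_succ, Nat.cast_mul,
      ENNReal.mul_inv (by simp) (by simp), mul_comm (_⁻¹ : ℝ≥0∞)]

lemma iterate_HI_congr {I : ℝ → ℝ} {a : ℝ} (h : EqOn I J (Ici a)) (m : ℕ) (f : ℝ → ℝ≥0∞) :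
    EqOn ((HI I)^[m] f) ((HI J)^[m] f) (Ici a) := by
  induction m with
  | zero => exact fun _ _ => rfl
  | succ m ih =>
    intro t ht
    simp only [Function.iterate_succ_apply']
    refine setLIntegral_congr_fun measurableSet_Ioi fun s hs => ?_
    have hs' : s ∈ Ici a := le_trans (mem_Ici.1 ht) (le_of_lt hs)
    simp only [h hs', ih hs']

lemma kernelOp_congr {I : ℝ → ℝ} {a : ℝ} (h : EqOn I J (Ici a)) (m : ℕ) (f : ℝ → ℝ≥0∞) :
    kernelOp I m f a = kernelOp J m f a := by
  refine setLIntegral_congr_fun measurableSet_Ioi fun s hs => ?_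
  have hP : ∫ r in a..s, 1 / I r = ∫ r in a..s, 1 / J r := by
    refine intervalIntegral.integral_congr fun r hr => ?_
    rw [uIcc_of_le (le_of_lt hs)] at hr
    simp only [h hr.1]
  simp only [h (le_of_lt hs : a ≤ s), hP]

end ClosedFormula

/-- the closed formula for `H_I^m`. -/
theorem statement10 (I : ℝ → ℝ) (hI : MonotoneOn I (Set.Ioi 0))
    (hIpos : ∀ t ∈ Set.Ioi (0 : ℝ), 0 < I t)
    (m : ℕ) (hm : 1 ≤ m) (f : ℝ → ℝ≥0∞) (hf : Measurable f) :
    ∀ t ∈ Set.Ioi (0 : ℝ),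
      (HI I)^[m] f t = ((Nat.factorial (m - 1) : ℝ≥0∞))⁻¹ * kernelOp I m f t := by
  intro t ht
  obtain ⟨n, rfl⟩ := Nat.exists_eq_add_of_le' hm
  have hmax : ∀ x, max x t ∈ Ioi (0 : ℝ) := fun x => lt_max_of_lt_right (mem_Ioi.1 ht)
  let J : ℝ → ℝ := fun x => I (max x t)
  have hJ : Monotone J := fun x y hxy => hI (hmax x) (hmax y) (max_le_max_right t hxy)
  have hIJ : EqOn I J (Ici t) := fun x hx => by simp only [J, max_eq_left (mem_Ici.1 hx)]
  rw [iterate_HI_congr hIJ _ f self_mem_Ici, kernelOp_congr hIJ,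
    iterate_HI_eq_kernelOp hJ (fun x => hIpos _ (hmax x)) n hf, Nat.add_sub_cancel]
end
end

section
/- Let m ∈ ℕ and let I : (0,∞) → (0,∞) be a left-continuous non-decreasing function. Then for every non-negative measurable f on (0,∞), the function t ↦ R_I^m f*(t) is upper semi-continuous on (0,∞); consequently it attains its supremum over every closed bounded interval of (0,∞). -/
open MeasureTheory Set Filter
open scoped ENNReal NNReal Topology

noncomputable section

theorem antitone_rearr (f : ℝ → ℝ≥0∞) : Antitone (rearr f) := fun _ _ hst =>
  sInf_le_sInf fun _ hr => le_trans hr (ENNReal.ofReal_le_ofReal hst)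

/-- The primitive `t ↦ ∫_0^t g` is either infinite on all of `(0,∞)` or finite on all of it. -/
def PrimitiveDichotomy (g : ℝ → ℝ≥0∞) : Prop :=
  (∀ t, 0 < t → ∫⁻ s in Set.Ioc (0 : ℝ) t, g s = ∞) ∨
    ∀ t, 0 < t → ∫⁻ s in Set.Ioc (0 : ℝ) t, g s < ∞

theorem lintegral_Ioc_zero_le_add (g : ℝ → ℝ≥0∞) (t s : ℝ) :
    ∫⁻ x in Set.Ioc (0 : ℝ) s, g x ≤
      (∫⁻ x in Set.Ioc (0 : ℝ) t, g x) + ∫⁻ x in Set.Ioc t s, g x :=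
  (lintegral_mono_set Set.Ioc_subset_Ioc_union_Ioc).trans (lintegral_union_le _ _ _)

theorem primitiveDichotomy_of_bounded {g : ℝ → ℝ≥0∞}
    (h : ∀ a, 0 < a → ∫⁻ s in Set.Ioc (0 : ℝ) a, g s < ∞ →
      ∀ b, ∃ C : ℝ≥0∞, C < ∞ ∧ ∀ x ∈ Set.Ioc a b, g x ≤ C) :
    PrimitiveDichotomy g := by
  by_cases hfin : ∃ a, 0 < a ∧ ∫⁻ s in Set.Ioc (0 : ℝ) a, g s < ∞
  · obtain ⟨a, ha, hFa⟩ := hfin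
    refine Or.inr fun b _ => ?_
    obtain ⟨C, hC, hgC⟩ := h a ha hFa b
    refine (lintegral_Ioc_zero_le_add g a b).trans_lt (ENNReal.add_lt_top.2 ⟨hFa, ?_⟩)
    calc ∫⁻ x in Set.Ioc a b, g x ≤ ∫⁻ _ in Set.Ioc a b, C :=
          setLIntegral_mono measurable_const hgC
      _ = C * volume (Set.Ioc a b) := setLIntegral_const _ _
      _ < ∞ := ENNReal.mul_lt_top hC measure_Ioc_lt_top
  · push Not at hfin
    exact Or.inl fun t ht => top_le_iff.1 (hfin t ht)

theorem Antitone.primitiveDichotomy {g : ℝ → ℝ≥0∞} (hg : Antitone g) :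
    PrimitiveDichotomy g := by
  refine primitiveDichotomy_of_bounded fun a ha hFa b => ⟨g a, ?_, fun x hx => hg hx.1.le⟩
  have hle : g a * volume (Set.Ioc 0 a) ≤ ∫⁻ s in Set.Ioc (0 : ℝ) a, g s := by
    rw [← setLIntegral_const]
    exact setLIntegral_mono' measurableSet_Ioc fun x hx => hg hx.2
  refine lt_top_iff_ne_top.2 fun htop => (hle.trans_lt hFa).ne ?_
  rw [htop, ENNReal.top_mul]
  simpa using ha

theorem RI_eq_top {I : ℝ → ℝ} {g : ℝ → ℝ≥0∞} {t : ℝ}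
    (h : ∫⁻ s in Set.Ioc (0 : ℝ) t, g s = ∞) : RI I g t = ∞ := by
  rw [RI, h, ENNReal.top_div_of_ne_top ENNReal.ofReal_ne_top]

theorem PrimitiveDichotomy.RI {I : ℝ → ℝ} (hI : MonotoneOn I (Set.Ioi 0))
    (hIpos : ∀ t ∈ Set.Ioi (0 : ℝ), 0 < I t) {g : ℝ → ℝ≥0∞} (hg : PrimitiveDichotomy g) :
    PrimitiveDichotomy (RI I g) := by
  rcases hg with hg | hg
  · refine Or.inl fun t ht => ?_
    rw [setLIntegral_congr_fun measurableSet_Ioc fun s hs => RI_eq_top (I := I) (hg s hs.1),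
      setLIntegral_const, ENNReal.top_mul]
    simpa using ht
  · refine primitiveDichotomy_of_bounded fun a ha _ b => ?_
    rcases le_or_gt b a with hba | hab
    · exact ⟨0, ENNReal.zero_lt_top, fun x hx => absurd hx (by simp [Set.Ioc_eq_empty hba.not_gt])⟩
    · refine ⟨(∫⁻ s in Set.Ioc (0 : ℝ) b, g s) / ENNReal.ofReal (I a),
        ENNReal.div_lt_top (hg b (ha.trans hab)).ne (by simpa using hIpos a ha), fun x hx => ?_⟩
      exact ENNReal.div_le_div (lintegral_mono_set (Set.Ioc_subset_Ioc_right hx.2))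
        (ENNReal.ofReal_le_ofReal (hI ha (ha.trans hx.1) hx.1.le))

theorem tendsto_lintegral_Ioc_zero {g : ℝ → ℝ≥0∞} {t : ℝ} (ht : 0 < t)
    (hg : ∫⁻ s in Set.Ioc (0 : ℝ) (t + 1), g s < ∞) :
    Tendsto (fun s => ∫⁻ x in Set.Ioc t s, g x) (𝓝 t) (𝓝 0) := by
  have hvol : Tendsto (fun s => (volume.restrict (Set.Ioc (0 : ℝ) (t + 1))) (Set.Ioc t s))
      (𝓝 t) (𝓝 0) := by
    have hlim : Tendsto (fun s : ℝ => ENNReal.ofReal (s - t)) (𝓝 t) (𝓝 0) := by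
      have hcont : Continuous fun s : ℝ => ENNReal.ofReal (s - t) :=
        ENNReal.continuous_ofReal.comp (by fun_prop)
      simpa using hcont.tendsto t
    refine tendsto_of_tendsto_of_tendsto_of_le_of_le tendsto_const_nhds hlim
      (fun _ => zero_le) fun s => ?_
    exact (Measure.restrict_apply_le _ _).trans Real.volume_Ioc.le
  refine (tendsto_setLIntegral_zero hg.ne hvol).congr' ?_
  filter_upwards [eventually_lt_nhds (lt_add_one t)] with s hs
  rw [Measure.restrict_restrict measurableSet_Ioc,
    Set.inter_eq_left.2 (Set.Ioc_subset_Ioc ht.le hs.le)]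

theorem upperSemicontinuousOn_RI {I : ℝ → ℝ} (hI : MonotoneOn I (Set.Ioi 0))
    (hIpos : ∀ t ∈ Set.Ioi (0 : ℝ), 0 < I t)
    (hIlc : ∀ t ∈ Set.Ioi (0 : ℝ), Filter.Tendsto I (𝓝[<] t) (𝓝 (I t)))
    {g : ℝ → ℝ≥0∞} (hg : PrimitiveDichotomy g) :
    UpperSemicontinuousOn (RI I g) (Set.Ioi 0) := by
  intro t ht y hy
  have ht0 : 0 < t := ht
  rcases hg with hg | hg
  · rw [RI_eq_top (hg t ht)] at hy
    exact absurd hy not_top_lt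
  have hImin : Tendsto (fun s => I (min s t)) (𝓝 t) (𝓝 (I t)) := by
    have hle : Tendsto I (𝓝[≤] t) (𝓝 (I t)) := continuousWithinAt_Iio_iff_Iic.1 (hIlc t ht)
    refine hle.comp (tendsto_nhdsWithin_iff.2
      ⟨?_, Eventually.of_forall fun s => min_le_right s t⟩)
    have hcont : Continuous fun s : ℝ => min s t := by fun_prop
    simpa using hcont.tendsto t
  have hnum := (tendsto_const_nhds (x := ∫⁻ x in Set.Ioc (0 : ℝ) t, g x)).add
    (tendsto_lintegral_Ioc_zero ht0 (hg (t + 1) (by linarith)))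
  rw [add_zero] at hnum
  have hquot := ENNReal.Tendsto.div hnum
    (Or.inr (by simpa using hIpos t ht)) (ENNReal.tendsto_ofReal hImin)
    (Or.inl ENNReal.ofReal_ne_top)
  filter_upwards [mem_nhdsWithin_of_mem_nhds (hquot.eventually_lt_const hy),
    self_mem_nhdsWithin] with s hs hs0
  refine lt_of_le_of_lt (ENNReal.div_le_div (lintegral_Ioc_zero_le_add g t s) ?_) hs
  exact ENNReal.ofReal_le_ofReal (hI (lt_min hs0 ht0) hs0 (min_le_left s t))

theorem primitiveDichotomy_iterate_RI {I : ℝ → ℝ} (hI : MonotoneOn I (Set.Ioi 0))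
    (hIpos : ∀ t ∈ Set.Ioi (0 : ℝ), 0 < I t) {g : ℝ → ℝ≥0∞} (hg : PrimitiveDichotomy g)
    (n : ℕ) : PrimitiveDichotomy ((RI I)^[n] g) := by
  induction n with
  | zero => exact hg
  | succ n ih =>
    rw [Function.iterate_succ_apply']
    exact ih.RI hI hIpos

/-- `R_I^m f*` is upper semi-continuous on `(0,∞)` and attains its
supremum over every closed bounded interval in `(0,∞)`. -/
theorem statement11 (m : ℕ) (hm : 1 ≤ m) (I : ℝ → ℝ)
    (hI : MonotoneOn I (Set.Ioi 0))
    (hIpos : ∀ t ∈ Set.Ioi (0 : ℝ), 0 < I t)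
    (hIlc : ∀ t ∈ Set.Ioi (0 : ℝ), Filter.Tendsto I (𝓝[<] t) (𝓝 (I t)))
    (f : ℝ → ℝ≥0∞) (hf : Measurable f) :
    UpperSemicontinuousOn ((RI I)^[m] (rearr f)) (Set.Ioi 0) ∧
    ∀ a b : ℝ, 0 < a → a ≤ b →
      ∃ c ∈ Set.Icc a b, ∀ x ∈ Set.Icc a b,
        (RI I)^[m] (rearr f) x ≤ (RI I)^[m] (rearr f) c := by
  have husc : UpperSemicontinuousOn ((RI I)^[m] (rearr f)) (Set.Ioi 0) := by
    obtain ⟨n, rfl⟩ := Nat.exists_eq_add_of_le' hm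
    rw [Function.iterate_succ_apply']
    exact upperSemicontinuousOn_RI hI hIpos hIlc
      (primitiveDichotomy_iterate_RI hI hIpos (antitone_rearr f).primitiveDichotomy n)
  refine ⟨husc, fun a b ha hab => ?_⟩
  obtain ⟨c, hc, hmax⟩ := (husc.mono fun x hx => ha.trans_le hx.1).exists_isMaxOn
    (Set.nonempty_Icc.2 hab) isCompact_Icc
  exact ⟨c, hc, fun x hx => hmax hx⟩
end
end

section
/- Let m ∈ ℕ, let I : (0,∞) → (0,∞) be a left-continuous non-decreasing function such that Φ_I^m(t,s) is essentially decreasing in t, and let f be a non-negative measurable function on (0,∞) whose support has finite Lebesgue measure. If G_I^m f(t) < ∞ for all t ∈ (0,∞), then for every t ∈ (0,∞) the supremum defining G_I^m f(t) is attained: there exists c_t ≥ t such that G_I^m f(t) = R_I^m f*(c_t), and moreover G_I^m f(c_t) = R_I^m f*(c_t). -/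
open MeasureTheory Set Filter
open scoped ENNReal NNReal Topology

noncomputable section

/-! ### Integration of powers of a primitive -/

theorem integral_mul_primitive_pow {a : ℝ → ℝ} {r t : ℝ} (hrt : r ≤ t)
    (ha : AntitoneOn a (Icc r t)) (n : ℕ) :
    ∫ s in r..t, a s * (∫ x in r..s, a x) ^ n = (∫ x in r..t, a x) ^ (n + 1) / (n + 1) := by
  have hint : IntervalIntegrable a volume r t := by
    apply AntitoneOn.intervalIntegrable
    rwa [uIcc_of_le hrt]
  have hcont : ContinuousOn (fun s => ∫ x in r..s, a x) (Icc r t) := by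
    have := intervalIntegral.continuousOn_primitive_interval' hint left_mem_uIcc
    rwa [uIcc_of_le hrt] at this
  have hmeas : AEStronglyMeasurable a (volume.restrict (Ioo r t)) :=
    (aemeasurable_restrict_of_antitoneOn measurableSet_Ioo
      (ha.mono Ioo_subset_Icc_self)).aestronglyMeasurable
  have key := MeasureTheory.integral_eq_of_hasDerivAt_off_countable_of_le
    (fun s => (∫ x in r..s, a x) ^ (n + 1) / (n + 1))
    (fun s => a s * (∫ x in r..s, a x) ^ n) hrt ha.countable_not_continuousWithinAt
    ((hcont.pow _).div_const _) ?_ ?_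
  · simpa using key
  · rintro x ⟨hx, hxs⟩
    have hxc : ContinuousAt a x := by
      by_contra h
      refine hxs ⟨Ioo_subset_Icc_self hx, fun hw => h (hw.continuousAt (Icc_mem_nhds hx.1 hx.2))⟩
    have hd : HasDerivAt (fun s => ∫ x in r..s, a x) (a x) x :=
      intervalIntegral.integral_hasDerivAt_right
        (hint.mono_set (by
          rw [uIcc_of_le hrt, uIcc_of_le hx.1.le]
          exact Icc_subset_Icc_right hx.2.le))
        ⟨Ioo r t, Ioo_mem_nhds hx.1 hx.2, hmeas⟩ hxc
    have hd' := (hd.pow (n + 1)).div_const ((n : ℝ) + 1)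
    refine hd'.congr_deriv ?_
    have : (n : ℝ) + 1 ≠ 0 := by positivity
    rw [div_eq_iff this, Nat.add_sub_cancel]
    push_cast
    ring
  · apply hint.mul_continuousOn
    rw [uIcc_of_le hrt]
    exact hcont.pow n

theorem lintegral_inv_ofReal_eq {J : ℝ → ℝ} (hJ : Monotone J) (hpos : ∀ x, 0 < x → 0 < J x)
    {r t : ℝ} (hr : 0 < r) (hrt : r ≤ t) :
    ∫⁻ x in Ioc r t, (ENNReal.ofReal (J x))⁻¹ = ENNReal.ofReal (∫ x in r..t, 1 / J x) := by
  have hanti : AntitoneOn (fun x => 1 / J x) (Icc r t) := fun x hx y _ hxy =>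
    one_div_le_one_div_of_le (hpos x (hr.trans_le hx.1)) (hJ hxy)
  have hint : IntervalIntegrable (fun x => 1 / J x) volume r t := by
    apply AntitoneOn.intervalIntegrable
    rwa [uIcc_of_le hrt]
  rw [intervalIntegral.integral_of_le hrt, ofReal_integral_eq_lintegral_ofReal
    ((intervalIntegrable_iff_integrableOn_Ioc_of_le hrt).1 hint)]
  · refine setLIntegral_congr_fun measurableSet_Ioc fun x hx => ?_
    simp only [one_div]
    rw [ENNReal.ofReal_inv_of_pos (hpos x (hr.trans hx.1))]
  · refine (ae_restrict_iff' measurableSet_Ioc).2 (.of_forall fun x hx => ?_)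
    exact (one_div_pos.2 (hpos x (hr.trans hx.1))).le

theorem lintegral_inv_mul_pow {J : ℝ → ℝ} (hJ : Monotone J) (hpos : ∀ x, 0 < x → 0 < J x)
    {r t : ℝ} (hr : 0 < r) (hrt : r ≤ t) (n : ℕ) :
    ∫⁻ s in Ioc r t, (ENNReal.ofReal (J s))⁻¹ * (∫⁻ x in Ioc r s, (ENNReal.ofReal (J x))⁻¹) ^ n
      = (∫⁻ x in Ioc r t, (ENNReal.ofReal (J x))⁻¹) ^ (n + 1) / (n + 1) := by
  have hanti : AntitoneOn (fun x => 1 / J x) (Icc r t) := fun x hx y _ hxy =>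
    one_div_le_one_div_of_le (hpos x (hr.trans_le hx.1)) (hJ hxy)
  have hint : IntervalIntegrable (fun x => 1 / J x) volume r t := by
    apply AntitoneOn.intervalIntegrable
    rwa [uIcc_of_le hrt]
  have hcont : ContinuousOn (fun s => ∫ x in r..s, 1 / J x) (uIcc r t) :=
    intervalIntegral.continuousOn_primitive_interval' hint left_mem_uIcc
  have hnn : ∀ s, r ≤ s → 0 ≤ ∫ x in r..s, 1 / J x := fun s hs =>
    intervalIntegral.integral_nonneg hs fun x hx =>
      (one_div_pos.2 (hpos x (hr.trans_le hx.1))).le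
  have hfin : ((n : ℝ≥0∞) + 1) = ENNReal.ofReal ((n : ℝ) + 1) := by
    rw [ENNReal.ofReal_add (by positivity) zero_le_one]; simp
  rw [lintegral_inv_ofReal_eq hJ hpos hr hrt, ← ENNReal.ofReal_pow (hnn t hrt), hfin,
    ← ENNReal.ofReal_div_of_pos (by positivity), ← integral_mul_primitive_pow hrt hanti n,
    intervalIntegral.integral_of_le hrt, ofReal_integral_eq_lintegral_ofReal
    ((intervalIntegrable_iff_integrableOn_Ioc_of_le hrt).1 (hint.mul_continuousOn (g := fun s => (∫ x in r..s, 1 / J x) ^ n) (hcont.pow n)))]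
  · refine setLIntegral_congr_fun measurableSet_Ioc fun s hs => ?_
    have hs0 := hpos s (hr.trans hs.1)
    rw [lintegral_inv_ofReal_eq hJ hpos hr hs.1.le, ENNReal.ofReal_mul (one_div_pos.2 hs0).le,
      ENNReal.ofReal_pow (hnn s hs.1.le), one_div (J s), ENNReal.ofReal_inv_of_pos hs0]
  · refine (ae_restrict_iff' measurableSet_Ioc).2 (.of_forall fun s hs => ?_)
    exact mul_nonneg (one_div_pos.2 (hpos s (hr.trans hs.1))).le (pow_nonneg (hnn s hs.1.le) n)

/-! ### The iterated operator as a single integral -/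

theorem measurable_lintegral_Ioc_prod {b : ℝ → ℝ≥0∞} (hb : Measurable b) :
    Measurable fun p : ℝ × ℝ => ∫⁻ x in Ioc p.1 p.2, b x := by
  have h : Measurable fun q : (ℝ × ℝ) × ℝ =>
      {q : (ℝ × ℝ) × ℝ | q.1.1 < q.2 ∧ q.2 ≤ q.1.2}.indicator (fun q => b q.2) q := by
    refine (hb.comp measurable_snd).indicator ?_
    exact (measurableSet_lt (measurable_fst.comp measurable_fst) measurable_snd).inter
      (measurableSet_le measurable_snd (measurable_snd.comp measurable_fst))
  convert h.lintegral_prod_right' (ν := volume) using 2 with p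
  rw [← lintegral_indicator measurableSet_Ioc]
  rfl

theorem lintegral_Ioc_swap {F : ℝ → ℝ → ℝ≥0∞} (hF : Measurable (Function.uncurry F)) (t : ℝ) :
    ∫⁻ s in Ioc 0 t, ∫⁻ r in Ioc 0 s, F r s = ∫⁻ r in Ioc 0 t, ∫⁻ s in Ioc r t, F r s := by
  have hset : MeasurableSet {p : ℝ × ℝ | 0 < p.2 ∧ p.2 < p.1 ∧ p.1 ≤ t} :=
    (measurableSet_lt measurable_const measurable_snd).inter
      ((measurableSet_lt measurable_snd measurable_fst).inter
        (measurableSet_le measurable_fst measurable_const))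
  let G : ℝ → ℝ → ℝ≥0∞ := fun s r =>
    {p : ℝ × ℝ | 0 < p.2 ∧ p.2 < p.1 ∧ p.1 ≤ t}.indicator (fun p => F p.2 p.1) (s, r)
  have hG : Measurable (Function.uncurry G) := (hF.comp measurable_swap).indicator hset
  have hswap := lintegral_lintegral_swap (μ := volume) (ν := volume) hG.aemeasurable
  convert hswap using 1
  · rw [← lintegral_indicator measurableSet_Ioc]
    refine lintegral_congr fun s => ?_
    by_cases hs : s ∈ Ioc 0 t
    · rw [indicator_of_mem hs, ← setLIntegral_congr Ioo_ae_eq_Ioc,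
        ← lintegral_indicator measurableSet_Ioo]
      refine lintegral_congr fun r => ?_
      simp only [G, indicator, mem_Ioo, mem_ofPred_eq]
      simp [hs.2]
    · rw [indicator_of_notMem hs]
      refine (lintegral_eq_zero_of_ae_eq_zero (.of_forall fun r => ?_)).symm
      refine indicator_of_notMem (fun h => hs ⟨h.1.trans h.2.1, h.2.2⟩) _
  · rw [← lintegral_indicator measurableSet_Ioc]
    refine lintegral_congr fun r => ?_
    by_cases hr : r ∈ Ioc 0 t
    · rw [indicator_of_mem hr, ← lintegral_indicator measurableSet_Ioc]
      refine lintegral_congr fun s => ?_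
      simp only [G, indicator, mem_Ioc, mem_ofPred_eq]
      simp [hr.1]
    · rw [indicator_of_notMem hr]
      refine (lintegral_eq_zero_of_ae_eq_zero (.of_forall fun s => ?_)).symm
      refine indicator_of_notMem (fun h => hr ⟨h.1, h.2.1.le.trans h.2.2⟩) _

theorem RI_iterate_succ_eq {J : ℝ → ℝ} (hJ : Monotone J) (hpos : ∀ x, 0 < x → 0 < J x)
    {g : ℝ → ℝ≥0∞} (hg : Measurable g) (n : ℕ) {t : ℝ} (ht : 0 < t) :
    (RI J)^[n + 1] g t = (∫⁻ r in Ioc 0 t, g r *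
      ((∫⁻ x in Ioc r t, (ENNReal.ofReal (J x))⁻¹) ^ n / n.factorial)) / ENNReal.ofReal (J t) := by
  induction n generalizing t with
  | zero => simp [RI]
  | succ n ih =>
    have hb : Measurable fun x => (ENNReal.ofReal (J x))⁻¹ := hJ.measurable.ennreal_ofReal.inv
    have hk := measurable_lintegral_Ioc_prod hb
    have hk' : ∀ s, Measurable fun r => ∫⁻ x in Ioc r s, (ENNReal.ofReal (J x))⁻¹ := fun s =>
      hk.comp (measurable_id.prodMk measurable_const)
    rw [Function.iterate_succ_apply', RI]
    congr 1
    calc ∫⁻ s in Ioc 0 t, (RI J)^[n + 1] g s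
        = ∫⁻ s in Ioc 0 t, ∫⁻ r in Ioc 0 s, g r *
          ((∫⁻ x in Ioc r s, (ENNReal.ofReal (J x))⁻¹) ^ n / n.factorial)
            * (ENNReal.ofReal (J s))⁻¹ := by
          refine setLIntegral_congr_fun measurableSet_Ioc fun s hs => ?_
          rw [ih hs.1, ENNReal.div_eq_inv_mul, mul_comm, lintegral_mul_const]
          exact hg.mul (((hk' s).pow_const n).div_const _)
      _ = ∫⁻ r in Ioc 0 t, ∫⁻ s in Ioc r t, g r *
          ((∫⁻ x in Ioc r s, (ENNReal.ofReal (J x))⁻¹) ^ n / n.factorial)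
            * (ENNReal.ofReal (J s))⁻¹ := by
          refine lintegral_Ioc_swap (F := fun r s => g r *
            ((∫⁻ x in Ioc r s, (ENNReal.ofReal (J x))⁻¹) ^ n / n.factorial)
              * (ENNReal.ofReal (J s))⁻¹) ?_ t
          exact ((hg.comp measurable_fst).mul ((hk.pow_const n).div_const _)).mul
            (hb.comp measurable_snd)
      _ = _ := by
          refine setLIntegral_congr_fun measurableSet_Ioc fun r hr => ?_
          have hmeas : Measurable fun s => (ENNReal.ofReal (J s))⁻¹ *
              (∫⁻ x in Ioc r s, (ENNReal.ofReal (J x))⁻¹) ^ n :=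
            hb.mul ((hk.comp (measurable_const.prodMk measurable_id)).pow_const n)
          have hpow := lintegral_inv_mul_pow hJ hpos hr.1 hr.2 n
          calc _ = ∫⁻ s in Ioc r t, (g r * (n.factorial : ℝ≥0∞)⁻¹) * ((ENNReal.ofReal (J s))⁻¹ *
              (∫⁻ x in Ioc r s, (ENNReal.ofReal (J x))⁻¹) ^ n) := by
                refine lintegral_congr fun s => ?_
                rw [div_eq_mul_inv]; ring
            _ = _ := by
                rw [lintegral_const_mul _ hmeas, hpow, Nat.factorial_succ, div_eq_mul_inv,
                  div_eq_mul_inv, Nat.cast_mul, ENNReal.mul_inv (by simp) (by simp)]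
                push_cast
                ring

/-! ### Semicontinuity -/

theorem measurable_RI {J : ℝ → ℝ} (hJ : Monotone J) (g : ℝ → ℝ≥0∞) : Measurable (RI J g) := by
  have hmono : Monotone fun t => ∫⁻ s in Ioc (0 : ℝ) t, g s := fun x y hxy =>
    lintegral_mono_set (Ioc_subset_Ioc_right hxy)
  exact hmono.measurable.div hJ.measurable.ennreal_ofReal

theorem continuousOn_lintegral_Ioc {g : ℝ → ℝ≥0∞} (hg : Measurable g)
    (hfin : ∀ t, 0 < t → ∫⁻ s in Ioc 0 t, g s ≠ ∞) :
    ContinuousOn (fun t => ∫⁻ s in Ioc 0 t, g s) (Ioi 0) := by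
  intro t ht
  have ht : 0 < t := ht
  have h1 : (0 : ℝ) < t + 1 := by linarith
  have hint : IntegrableOn (fun s => (g s).toReal) (Icc 0 (t + 1)) := by
    rw [integrableOn_Icc_iff_integrableOn_Ioc]
    exact integrable_toReal_of_lintegral_ne_top hg.aemeasurable (hfin _ h1)
  have hc := (intervalIntegral.continuousOn_primitive hint).continuousAt
    (Icc_mem_nhds ht (by linarith))
  refine ContinuousAt.continuousWithinAt ?_
  refine (ENNReal.continuous_ofReal.continuousAt.comp hc).congr ?_
  filter_upwards [Ioi_mem_nhds ht] with x hx
  have hx0 : (0 : ℝ) < x := hx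
  simp only [Function.comp]
  rw [integral_toReal hg.aemeasurable (ae_lt_top hg (hfin x hx0)), ENNReal.ofReal_toReal (hfin x hx0)]

theorem upperSemicontinuousOn_RI_s14 {J : ℝ → ℝ} (hJ : Monotone J) (hpos : ∀ x, 0 < x → 0 < J x)
    (hlc : ∀ x, 0 < x → Tendsto J (𝓝[<] x) (𝓝 (J x))) {g : ℝ → ℝ≥0∞} (hg : Measurable g)
    (hfin : ∀ t, 0 < t → ∫⁻ s in Ioc 0 t, g s ≠ ∞) :
    UpperSemicontinuousOn (RI J g) (Ioi 0) := by
  intro c hc y hy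
  have hc : 0 < c := hc
  have hJmin : Tendsto (fun x => J (min x c)) (𝓝 c) (𝓝 (J c)) := by
    have hw : ContinuousWithinAt J (Iic c) c :=
      continuousWithinAt_Iio_iff_Iic.1 (hlc c hc)
    refine Tendsto.comp hw (tendsto_nhdsWithin_iff.2 ⟨?_, .of_forall fun x => min_le_right x c⟩)
    have : Continuous fun x => min x c := by fun_prop
    simpa using this.tendsto c
  have hF := (continuousOn_lintegral_Ioc hg hfin) c hc
  have hlim : Tendsto (fun x => (∫⁻ s in Ioc 0 x, g s) / ENNReal.ofReal (J (min x c)))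
      (𝓝[Ioi 0] c) (𝓝 (RI J g c)) :=
    ENNReal.Tendsto.div hF (.inr (by simpa using hpos c hc))
      ((ENNReal.tendsto_ofReal hJmin).mono_left nhdsWithin_le_nhds) (.inl (by simp))
  filter_upwards [hlim.eventually (gt_mem_nhds hy)] with x hx
  refine lt_of_le_of_lt ?_ hx
  exact ENNReal.div_le_div_left (ENNReal.ofReal_le_ofReal (hJ (min_le_left x c))) _

theorem rearr_eq_zero {f : ℝ → ℝ≥0∞}
    (hsupp : volume {t : ℝ | t ∈ Ioi (0 : ℝ) ∧ f t ≠ 0} < ∞) {t : ℝ}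
    (ht : (volume {t : ℝ | t ∈ Ioi (0 : ℝ) ∧ f t ≠ 0}).toReal ≤ t) : rearr f t = 0 := by
  refine le_antisymm (sInf_le ?_) zero_le
  simp only [mem_ofPred_eq, distrib, pos_iff_ne_zero]
  exact (ENNReal.le_ofReal_iff_toReal_le hsupp.ne (ENNReal.toReal_nonneg.trans ht)).2 ht

/-! ### Behaviour at infinity -/

theorem RI_iterate_le_of_Phi_le {J : ℝ → ℝ} (hJ : Monotone J) (hpos : ∀ x, 0 < x → 0 < J x)
    {g : ℝ → ℝ≥0∞} (hg : Measurable g) {s₀ : ℝ} (hgs : ∀ s, s₀ ≤ s → g s = 0) (n : ℕ) {t r : ℝ}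
    (ht : 0 < t) (hst : s₀ ≤ t) (htr : t ≤ r)
    (hPhi : ∀ s ∈ Ioo 0 s₀, Phi J (n + 1) r s ≤ Phi J (n + 1) t s) :
    (RI J)^[n + 1] g r ≤ (RI J)^[n + 1] g t := by
  have hform : ∀ x, 0 < x → s₀ ≤ x → (RI J)^[n + 1] g x =
      ∫⁻ s in Ioo 0 s₀, g s * (ENNReal.ofReal (Phi J (n + 1) x s) / n.factorial) := by
    intro x hx hsx
    have hk : Measurable fun s => ∫⁻ y in Ioc s x, (ENNReal.ofReal (J y))⁻¹ :=
      (measurable_lintegral_Ioc_prod hJ.measurable.ennreal_ofReal.inv).comp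
        (measurable_id.prodMk measurable_const)
    rw [RI_iterate_succ_eq hJ hpos hg n hx, div_eq_mul_inv,
      ← lintegral_mul_const _ (by
        exact hg.mul ((hk.pow_const n).div_const _)),
      ← lintegral_indicator measurableSet_Ioc, ← lintegral_indicator measurableSet_Ioo]
    refine lintegral_congr fun s => ?_
    by_cases hs : s ∈ Ioo 0 s₀
    · have hsx' : s ≤ x := hs.2.le.trans hsx
      rw [indicator_of_mem hs, indicator_of_mem (mem_Ioc.2 ⟨hs.1, hsx'⟩)]
      have hnn : 0 ≤ ∫ y in s..x, 1 / J y :=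
        intervalIntegral.integral_nonneg hsx' fun y hy =>
          (one_div_pos.2 (hpos y (hs.1.trans_le hy.1))).le
      rw [lintegral_inv_ofReal_eq hJ hpos hs.1 hsx', Phi, Nat.add_sub_cancel,
        ENNReal.ofReal_div_of_pos (hpos x hx), ENNReal.ofReal_pow hnn]
      simp only [div_eq_mul_inv]
      ring
    · rw [indicator_of_notMem hs]
      refine indicator_apply_eq_zero.2 fun hs' => ?_
      rw [hgs s (not_lt.1 fun h => hs ⟨hs'.1, h⟩)]
      simp
  rw [hform t ht hst, hform r (ht.trans_le htr) (hst.trans htr)]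
  refine setLIntegral_mono' measurableSet_Ioo fun s hs => ?_
  gcongr
  exact hPhi s hs

/-! ### Reduction to globally monotone weights -/

theorem monotone_indicator_Ioi {I : ℝ → ℝ} (hI : MonotoneOn I (Ioi 0))
    (hIpos : ∀ t ∈ Ioi (0 : ℝ), 0 < I t) : Monotone ((Ioi 0).indicator I) := by
  intro x y hxy
  by_cases hx : x ∈ Ioi (0 : ℝ)
  · have hy : y ∈ Ioi (0 : ℝ) := lt_of_lt_of_le hx hxy
    rw [indicator_of_mem hx, indicator_of_mem hy]
    exact hI hx hy hxy
  · rw [indicator_of_notMem hx]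
    exact indicator_nonneg (fun y hy => (hIpos y hy).le) y

theorem RI_indicator_Ioi (I : ℝ → ℝ) : RI ((Ioi 0).indicator I) = RI I := by
  ext g t
  by_cases ht : t ∈ Ioi (0 : ℝ)
  · simp [RI, indicator_of_mem ht]
  · have h : Ioc 0 t = ∅ := Ioc_eq_empty (by simpa using ht)
    simp [RI, h]

theorem Phi_indicator_Ioi (I : ℝ → ℝ) (m : ℕ) {t s : ℝ} (ht : 0 < t) (hs : 0 < s) :
    Phi ((Ioi 0).indicator I) m t s = Phi I m t s := by
  rw [Phi, Phi, indicator_of_mem (mem_Ioi.2 ht)]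
  congr 2
  refine intervalIntegral.integral_congr fun x hx => ?_
  have hx0 : x ∈ Ioi (0 : ℝ) := lt_of_lt_of_le (lt_min hs ht) hx.1
  simp only [indicator_of_mem hx0]

/-- A function that is upper semicontinuous and eventually bounded by one of its values attains
its supremum over every right half-line. -/
theorem exists_forall_le_of_upperSemicontinuousOn {u : ℝ → ℝ≥0∞} {t t₁ r₁ : ℝ}
    (hu : UpperSemicontinuousOn u (Ici t)) (ht₁ : t ≤ t₁) (hr : ∀ r, r₁ < r → u r ≤ u t₁) :
    ∃ c, t ≤ c ∧ ∀ s, t ≤ s → u s ≤ u c := by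
  obtain ⟨c, hc, hmax⟩ := UpperSemicontinuousOn.exists_isMaxOn
    (s := Icc t (max t₁ r₁)) ⟨t₁, ht₁, le_max_left _ _⟩ isCompact_Icc
    (hu.mono Icc_subset_Ici_self)
  refine ⟨c, hc.1, fun s hs => ?_⟩
  rcases le_or_gt s (max t₁ r₁) with h | h
  · exact hmax ⟨hs, h⟩
  · exact (hr s ((le_max_right _ _).trans_lt h)).trans (hmax ⟨ht₁, le_max_left _ _⟩)

/-- attainment of the supremum defining `G_I^m f`. -/
theorem statement14 (m : ℕ) (hm : 1 ≤ m) (I : ℝ → ℝ)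
    (hI : MonotoneOn I (Set.Ioi 0))
    (hIpos : ∀ t ∈ Set.Ioi (0 : ℝ), 0 < I t)
    (hIlc : ∀ t ∈ Set.Ioi (0 : ℝ), Filter.Tendsto I (𝓝[<] t) (𝓝 (I t)))
    (hPhi : EssentiallyDecreasingIn I m)
    (f : ℝ → ℝ≥0∞) (hf : Measurable f)
    (hsupp : volume {t : ℝ | t ∈ Set.Ioi (0 : ℝ) ∧ f t ≠ 0} < ∞)
    (hfin : ∀ t ∈ Set.Ioi (0 : ℝ), GI I m f t < ∞) :
    ∀ t ∈ Set.Ioi (0 : ℝ), ∃ c : ℝ, t ≤ c ∧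
      GI I m f t = (RI I)^[m] (rearr f) c ∧
      GI I m f c = (RI I)^[m] (rearr f) c := by
  obtain ⟨n, rfl⟩ : ∃ n, m = n + 1 := ⟨m - 1, by omega⟩
  set J : ℝ → ℝ := (Ioi 0).indicator I with hJdef
  have hJI : ∀ x, 0 < x → J x = I x := fun x hx => indicator_of_mem (mem_Ioi.2 hx) I
  have hJ : Monotone J := monotone_indicator_Ioi hI hIpos
  have hpos : ∀ x, 0 < x → 0 < J x := fun x hx => by
    rw [hJI x hx]
    exact hIpos x hx
  have hlc : ∀ x, 0 < x → Tendsto J (𝓝[<] x) (𝓝 (J x)) := fun x hx => by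
    rw [hJI x hx]
    refine (hIlc x hx).congr' ?_
    filter_upwards [mem_nhdsWithin_of_mem_nhds (Ioi_mem_nhds hx)] with y hy
    exact (hJI y hy).symm
  have hRI : RI J = RI I := RI_indicator_Ioi I
  have hmeas : Measurable (rearr f) := (antitone_rearr f).measurable
  have hmeasn : Measurable ((RI J)^[n] (rearr f)) := by
    cases n with
    | zero => exact hmeas
    | succ k =>
      rw [Function.iterate_succ_apply']
      exact measurable_RI hJ _
  have hle : ∀ t s, t ≤ s → (RI I)^[n + 1] (rearr f) s ≤ GI I (n + 1) f t := fun t s hs =>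
    le_iSup₂ (f := fun s (_ : s ∈ Ici t) => (RI I)^[n + 1] (rearr f) s) s hs
  have hprim : ∀ t, 0 < t → ∫⁻ s in Ioc 0 t, (RI J)^[n] (rearr f) s ≠ ∞ := by
    intro t ht h
    refine ((hle t t le_rfl).trans_lt (hfin t ht)).ne ?_
    rw [← hRI, Function.iterate_succ_apply', RI, h, ENNReal.top_div_of_ne_top ENNReal.ofReal_ne_top]
  have husc : UpperSemicontinuousOn ((RI I)^[n + 1] (rearr f)) (Ioi 0) := by
    rw [← hRI, Function.iterate_succ_apply']
    exact upperSemicontinuousOn_RI_s14 hJ hpos hlc hmeasn hprim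
  intro t ht
  set L := (volume {t : ℝ | t ∈ Ioi (0 : ℝ) ∧ f t ≠ 0}).toReal with hL
  have hL0 : 0 ≤ L := ENNReal.toReal_nonneg
  obtain ⟨t₀, -, ht₀⟩ := hPhi (L + 1) (mem_Ioi.2 (by linarith))
  set t₁ := max t (max (L + 1) (t₀ + 1)) with ht₁
  have htt₁ : t ≤ t₁ := le_max_left _ _
  have hLt₁ : L + 1 ≤ t₁ := (le_max_left _ _).trans (le_max_right _ _)
  have ht₀t₁ : t₀ + 1 ≤ t₁ := (le_max_right _ _).trans (le_max_right _ _)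
  obtain ⟨r₁, -, hr₁⟩ := ht₀ t₁ (mem_Ioi.2 (by linarith))
  have ht₁0 : 0 < t₁ := lt_of_lt_of_le ht htt₁
  have hfar : ∀ r, max r₁ t₁ < r →
      (RI I)^[n + 1] (rearr f) r ≤ (RI I)^[n + 1] (rearr f) t₁ := by
    intro r hr
    have hr0 : t₁ < r := (le_max_right _ _).trans_lt hr
    rw [← hRI]
    refine RI_iterate_le_of_Phi_le hJ hpos hmeas (s₀ := L + 1)
      (fun s hs => rearr_eq_zero hsupp (by linarith)) n ht₁0 hLt₁ hr0.le fun s hs => ?_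
    rw [Phi_indicator_Ioi I _ (ht₁0.trans hr0) hs.1, Phi_indicator_Ioi I _ ht₁0 hs.1]
    exact hr₁ r ((le_max_left _ _).trans_lt hr) s hs
  obtain ⟨c, htc, hc⟩ := exists_forall_le_of_upperSemicontinuousOn
    (husc.mono fun x hx => mem_Ioi.2 (lt_of_lt_of_le ht hx)) htt₁ hfar
  exact ⟨c, htc, le_antisymm (iSup₂_le hc) (hle t c htc),
    le_antisymm (iSup₂_le fun s hs => hc s (htc.trans hs)) (hle c c le_rfl)⟩
end
end
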